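/- Let a_1, a_2 \ge 1 be integers, let d = \gcd(a_1, a_2), and let c be an element of the circle group \mathbb{R}/\mathbb{Z}. Consider, in the torus (\mathbb{R}/\mathbb{Z})^2, the antidiagonal \Delta = \{(\theta, -\theta) : \theta \in \mathbb{R}/\mathbb{Z}\} and the curve \mathcal{C}_{a_1, a_2, c} = \{(a_1 \theta, c + a_2 \theta) : \theta \in \mathbb{R}/\mathbb{Z}\}. Then the intersection \Delta \cap \mathcal{C}_{a_1, a_2, c} consists of exactly (a_1 + a_2)/d points, and for each point p of this intersection the set \{\theta \in \mathbb{R}/\mathbb{Z} : (a_1 \theta, c + a_2 \theta) = p\} has exactly d elements. -/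

import Mathlib

theorem gcd_nsmul_eq_iff {A : Type*} [AddCommGroup A] (m n : ℕ) (x y : A) :
    m.gcd n • x = m.gcd n • y ↔ m • x = m • y ∧ n • x = n • y := by
  have key (k : ℕ) : k • x = k • y ↔ addOrderOf (x - y) ∣ k := by
    rw [addOrderOf_dvd_iff_nsmul_eq_zero, nsmul_sub, sub_eq_zero]
  rw [key, key, key, Nat.dvd_gcd_iff]

namespace AddCircle

theorem nsmul_surjective {p : ℝ} {n : ℕ} (hn : 0 < n) :
    Function.Surjective fun u : AddCircle p => n • u := by
  intro b
  induction b using QuotientAddGroup.induction_on with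
  | H x =>
    refine ⟨((x / n : ℝ) : AddCircle p), ?_⟩
    have hn' : (n : ℝ) ≠ 0 := by positivity
    change n • ((x / n : ℝ) : AddCircle p) = (x : AddCircle p)
    rw [← coe_nsmul, nsmul_eq_mul, mul_div_cancel₀ _ hn']

theorem ncard_nsmul_eq_zero {p : ℝ} [hp : Fact (0 < p)] {n : ℕ} (hn : 0 < n) :
    {u : AddCircle p | n • u = 0}.ncard = n := by
  have hn' : (0 : ℝ) < n := by exact_mod_cast hn
  have himage : {u : AddCircle p | n • u = 0} =
      (fun m : ℕ => ((m / n * p : ℝ) : AddCircle p)) '' (Finset.range n : Set ℕ) := by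
    ext u
    simp only [Set.mem_ofPred_eq, AddCircle.nsmul_eq_zero_iff hn, Set.mem_image,
      Finset.coe_range, Set.mem_Iio]
  have hinj : Set.InjOn (fun m : ℕ => ((m / n * p : ℝ) : AddCircle p))
      (Finset.range n : Set ℕ) := by
    have hmem (m : ℕ) (hm : m ∈ (Finset.range n : Set ℕ)) :
        (m / n * p : ℝ) ∈ Set.Ico (0 : ℝ) (0 + p) := by
      have hm' : (m : ℝ) < n := by simpa using hm
      refine ⟨mul_nonneg (by positivity) hp.out.le, ?_⟩
      rw [zero_add]
      exact mul_lt_of_lt_one_left hp.out ((div_lt_one hn').2 hm')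
    intro i hi j hj hij
    have h := (AddCircle.coe_eq_coe_iff_of_mem_Ico (hmem i hi) (hmem j hj)).1 hij
    have h' := (div_left_inj' hn'.ne').1 (mul_right_cancel₀ hp.out.ne' h)
    exact_mod_cast h'
  rw [himage, hinj.ncard_image, Set.ncard_coe_finset, Finset.card_range]

theorem ncard_nsmul_eq {p : ℝ} [Fact (0 < p)] {n : ℕ} (hn : 0 < n) (b : AddCircle p) :
    {u : AddCircle p | n • u = b}.ncard = n := by
  obtain ⟨v, rfl⟩ := nsmul_surjective hn b
  have h : {u : AddCircle p | n • u = n • v} = (· + v) '' {u | n • u = 0} := by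
    ext u
    simp [Set.image_add_right, ← sub_eq_add_neg, nsmul_sub, sub_eq_zero]
  change {u : AddCircle p | n • u = n • v}.ncard = n
  rw [h, Set.ncard_image_of_injective _ (add_left_injective v), ncard_nsmul_eq_zero hn]

end AddCircle

/-- In the torus `(ℝ/ℤ)²`, the antidiagonal `Δ = {(θ, -θ)}` meets the curve
`𝒞 = {(a₁θ, c + a₂θ)}` in exactly `(a₁ + a₂)/gcd(a₁,a₂)` points, and each point of the
intersection is hit by exactly `gcd(a₁,a₂)` parameters `θ`. -/
theorem antidiagonal_curve_intersection
    (a₁ a₂ : ℕ) (ha₁ : 1 ≤ a₁) (ha₂ : 1 ≤ a₂) (c : AddCircle (1 : ℝ)) :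
    let d := Nat.gcd a₁ a₂
    let Δ : Set (AddCircle (1 : ℝ) × AddCircle (1 : ℝ)) := {p | ∃ θ, p = (θ, -θ)}
    let 𝒞 : Set (AddCircle (1 : ℝ) × AddCircle (1 : ℝ)) := {p | ∃ θ, p = (a₁ • θ, c + a₂ • θ)}
    (Δ ∩ 𝒞).ncard = (a₁ + a₂) / d ∧
      ∀ p ∈ Δ ∩ 𝒞, {θ : AddCircle (1 : ℝ) | (a₁ • θ, c + a₂ • θ) = p}.ncard = d := by
  intro d Δ 𝒞
  have hd : 0 < d := Nat.gcd_pos_of_pos_left _ ha₁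
  constructor
  · obtain ⟨k₁, hk₁⟩ : d ∣ a₁ := Nat.gcd_dvd_left _ _
    obtain ⟨k₂, hk₂⟩ : d ∣ a₂ := Nat.gcd_dvd_right _ _
    have hcop : k₁.gcd k₂ = 1 := by
      have h : d = d * k₁.gcd k₂ := by
        rw [← Nat.gcd_mul_left, ← hk₁, ← hk₂]
      exact Nat.eq_of_mul_eq_mul_left hd (by rw [← h, mul_one])
    have hsum : (a₁ + a₂) / d = k₁ + k₂ := by
      rw [hk₁, hk₂, ← mul_add, Nat.mul_div_cancel_left _ hd]
    have hpos : 0 < k₁ + k₂ := by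
      have : 0 < k₁ := Nat.pos_of_ne_zero fun h => by simp [h] at hk₁; omega
      omega
    have hinj : Function.Injective
        fun φ : AddCircle (1 : ℝ) => (k₁ • φ, c + k₂ • φ) := by
      intro x y hxy
      simp only [Prod.mk.injEq, add_right_inj] at hxy
      simpa [hcop] using (gcd_nsmul_eq_iff k₁ k₂ x y).2 hxy
    have himage : Δ ∩ 𝒞 = (fun φ : AddCircle (1 : ℝ) => (k₁ • φ, c + k₂ • φ)) ''
        {φ | (k₁ + k₂) • φ = -c} := by
      ext p
      constructor
      · rintro ⟨⟨t, rfl⟩, θ, hθ⟩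
        rw [hk₁, hk₂, mul_comm d, mul_comm d, mul_nsmul', mul_nsmul', Prod.mk.injEq] at hθ
        obtain ⟨h₁, h₂⟩ := hθ
        refine ⟨d • θ, ?_, Prod.ext h₁.symm h₂.symm⟩
        rw [Set.mem_ofPred_eq, add_nsmul, ← h₁, eq_neg_iff_add_eq_zero, add_assoc, add_comm _ c,
          ← h₂, add_neg_cancel]
      · rintro ⟨φ, hφ, rfl⟩
        obtain ⟨θ, rfl⟩ := AddCircle.nsmul_surjective hd φ
        rw [Set.mem_ofPred_eq, add_nsmul] at hφ
        refine ⟨⟨k₁ • d • θ, Prod.ext rfl ?_⟩, θ, ?_⟩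
        · change c + k₂ • d • θ = -(k₁ • d • θ)
          rw [eq_neg_iff_add_eq_zero, add_assoc, add_comm (k₂ • _), hφ, add_neg_cancel]
        · rw [hk₁, hk₂, mul_comm d, mul_comm d, mul_nsmul', mul_nsmul']
    rw [himage, Set.ncard_image_of_injective _ hinj, AddCircle.ncard_nsmul_eq hpos, hsum]
  · rintro p ⟨-, θ₀, rfl⟩
    simp only [Prod.mk.injEq, add_right_inj, ← gcd_nsmul_eq_iff]
    exact AddCircle.ncard_nsmul_eq hd _
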